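/- arXiv:2209.07767 — 2 statements merged into one kernel-verified Lean document; each statement's English description precedes it below -/
import Mathlib

section
/- Let ν > -1/2 and 0 ≤ |β| < α, and let p be the variance-gamma density with parameters (ν, α, β, 0). Then for every odd positive integer k, the k-th moment satisfies ∫_ℝ x^k p(x) dx = (2^{k+1} β (1 - β²/α²)^{ν+1/2} / (√π α^{k+1} Γ(ν+1/2))) · Γ(ν + k/2 + 1) Γ(k/2 + 1) · ₂F₁(k/2 + 1, ν + k/2 + 1; 3/2; β²/α²). -/
open MeasureTheory Real Filter

/-- The modified Bessel function of the second kind `K_ν(x)`. -/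
noncomputable def besselK (ν x : ℝ) : ℝ :=
  ∫ t in Set.Ioi (0 : ℝ), Real.exp (-x * Real.cosh t) * Real.cosh (ν * t)

/-- The variance-gamma density with parameters `(ν, α, β, 0)`. -/
noncomputable def vgDensity (ν α β x : ℝ) : ℝ :=
  (α ^ 2 - β ^ 2) ^ (ν + 1/2) / (Real.sqrt π * (2 * α) ^ ν * Real.Gamma (ν + 1/2)) *
    (Real.exp (β * x) * |x| ^ ν * besselK ν (α * |x|))

/-- The ascending factorial `(u)_j = u (u+1) ⋯ (u+j-1)`. -/
noncomputable def ascFactorial (u : ℝ) (j : ℕ) : ℝ := ∏ i ∈ Finset.range j, (u + i)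

/-- The Gaussian hypergeometric function `₂F₁(a, b; c; x)`. -/
noncomputable def hyp2F1 (a b c x : ℝ) : ℝ :=
  ∑' j : ℕ, ascFactorial a j * ascFactorial b j / ascFactorial c j * x ^ j / (Nat.factorial j)

open ProbabilityTheory in
lemma vg_beta (a b : ℝ) (ha : 0 < a) (hb : 0 < b) :
    ∫ t : ℝ, Real.exp ((a - b) * t) * Real.cosh t ^ (-(a + b)) =
      2 ^ (a + b - 1) * (Real.Gamma a * Real.Gamma b / Real.Gamma (a + b)) := by
  have hB := beta_pos ha hb
  have h1 : ∫ x, betaPDFReal a b x = 1 := by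
    rw [integral_eq_lintegral_of_nonneg_ae]
    · have := lintegral_betaPDF_eq_one ha hb
      simp only [betaPDF] at this
      rw [this]; simp
    · refine Eventually.of_forall fun x => ?_
      by_cases hx : 0 < x ∧ x < 1
      · exact (betaPDFReal_pos hx.1 hx.2 ha hb).le
      · simp [betaPDFReal, hx]
    · exact (stronglyMeasurable_betaPDFReal a b).aestronglyMeasurable
  have h2 : ∫ x in Set.Ioo (0:ℝ) 1, betaPDFReal a b x = 1 := by
    refine (setIntegral_eq_integral_of_forall_compl_eq_zero ?_).trans h1
    intro x hx
    have : ¬ (0 < x ∧ x < 1) := hx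
    simp [betaPDFReal, this]
  have himg : (fun t : ℝ => Real.sigmoid (2 * t)) '' Set.univ = Set.Ioo 0 1 := by
    rw [← Real.range_sigmoid, Set.image_univ]
    ext y; constructor
    · rintro ⟨t, rfl⟩; exact ⟨_, rfl⟩
    · rintro ⟨t, rfl⟩; exact ⟨t / 2, by simp only; congr 1; ring⟩
  have hd : ∀ x ∈ (Set.univ : Set ℝ), HasDerivWithinAt (fun t : ℝ => Real.sigmoid (2 * t))
      (Real.sigmoid (2 * x) * (1 - Real.sigmoid (2 * x)) * (2 * 1)) Set.univ x := by
    intro x _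
    exact ((Real.hasDerivAt_sigmoid (2 * x)).comp x
      ((hasDerivAt_id x).const_mul 2)).hasDerivWithinAt
  have hinj : Set.InjOn (fun t : ℝ => Real.sigmoid (2 * t)) Set.univ := by
    intro x _ y _ h
    have := Real.sigmoid_injective h
    linarith
  rw [← himg, integral_image_eq_integral_abs_deriv_smul MeasurableSet.univ hd hinj,
    setIntegral_univ] at h2
  have key : ∀ t : ℝ, |Real.sigmoid (2 * t) * (1 - Real.sigmoid (2 * t)) * (2 * 1)| •
      betaPDFReal a b (Real.sigmoid (2 * t)) =
      (2 ^ (a + b - 1) * beta a b)⁻¹ * (Real.exp ((a - b) * t) * Real.cosh t ^ (-(a + b))) := by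
    intro t
    have hc := Real.cosh_pos t
    have hs0 := Real.sigmoid_pos (2 * t)
    have hs1 := Real.sigmoid_lt_one (2 * t)
    have e1 : Real.sigmoid (2 * t) = Real.exp t / (2 * Real.cosh t) := by
      rw [Real.sigmoid_def, Real.cosh_eq, eq_div_iff (by positivity), inv_mul_eq_iff_eq_mul₀ (by positivity)]
      have : Real.exp (-(2*t)) * Real.exp t = Real.exp (-t) := by rw [← Real.exp_add]; congr 1; ring
      linear_combination -this
    have e2 : 1 - Real.sigmoid (2 * t) = Real.exp (-t) / (2 * Real.cosh t) := by
      rw [e1, Real.cosh_eq]; field_simp; ring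
    have h1s : 0 < 1 - Real.sigmoid (2 * t) := by linarith
    rw [betaPDFReal, if_pos ⟨hs0, hs1⟩, abs_of_pos (by positivity), smul_eq_mul]
    have e3 : Real.sigmoid (2 * t) * (Real.sigmoid (2 * t)) ^ (a - 1) = Real.sigmoid (2 * t) ^ a := by
      rw [← Real.rpow_one_add' hs0.le (by linarith)]; congr 1; ring
    have e4 : (1 - Real.sigmoid (2 * t)) * (1 - Real.sigmoid (2 * t)) ^ (b - 1)
        = (1 - Real.sigmoid (2 * t)) ^ b := by
      rw [← Real.rpow_one_add' h1s.le (by linarith)]; congr 1; ring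
    have e5 : Real.sigmoid (2 * t) ^ a * (1 - Real.sigmoid (2 * t)) ^ b =
        Real.exp ((a - b) * t) * (2 ^ (-(a + b)) * Real.cosh t ^ (-(a + b))) := by
      rw [e2, e1, Real.div_rpow (by positivity) (by positivity),
        Real.div_rpow (by positivity) (by positivity), ← Real.exp_mul, ← Real.exp_mul,
        ← Real.mul_rpow (by norm_num) hc.le, Real.rpow_neg (by positivity),
        Real.rpow_add (by positivity), show (a - b) * t = t * a + -t * b by ring, Real.exp_add]
      field_simp
    have e6 : (2:ℝ) ^ (a + b - 1) = 2 ^ (a + b) / 2 := by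
      rw [Real.rpow_sub_one (by norm_num)]
    rw [Real.rpow_neg (by norm_num : (0:ℝ) ≤ 2)] at e5
    calc _ = 2 * (beta a b)⁻¹ * ((Real.sigmoid (2 * t) * (Real.sigmoid (2 * t)) ^ (a - 1)) *
        ((1 - Real.sigmoid (2 * t)) * (1 - Real.sigmoid (2 * t)) ^ (b - 1))) := by ring
      _ = _ := by
        rw [e3, e4, e5, e6]
        have : (0:ℝ) < 2 ^ (a + b) := by positivity
        field_simp
  simp_rw [key] at h2
  rw [integral_const_mul] at h2
  have hne : (2 ^ (a + b - 1) * beta a b) ≠ 0 := by positivity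
  rw [inv_mul_eq_iff_eq_mul₀ hne] at h2
  rw [h2, beta, mul_one]

lemma vg_J (ν μ : ℝ) (h : |ν| < μ) :
    IntegrableOn (fun t : ℝ => Real.cosh (ν * t) * Real.cosh t ^ (-μ)) (Set.Ioi 0) ∧
    ∫ t in Set.Ioi (0:ℝ), Real.cosh (ν * t) * Real.cosh t ^ (-μ) =
      2 ^ (μ - 2) * (Real.Gamma ((μ + ν) / 2) * Real.Gamma ((μ - ν) / 2) / Real.Gamma μ) := by
  obtain ⟨h1, h2⟩ := abs_lt.1 h
  have ha : 0 < (μ + ν) / 2 := by linarith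
  have hb : 0 < (μ - ν) / 2 := by linarith
  have H := vg_beta _ _ ha hb
  rw [show (μ + ν) / 2 + (μ - ν) / 2 = μ by ring,
    show (μ + ν) / 2 - (μ - ν) / 2 = ν by ring] at H
  have hμ : 0 < μ := by linarith
  have g1 := Real.Gamma_pos_of_pos ha
  have g2 := Real.Gamma_pos_of_pos hb
  have g3 := Real.Gamma_pos_of_pos hμ
  have hi : Integrable (fun t : ℝ => Real.exp (ν * t) * Real.cosh t ^ (-μ)) := by
    apply Integrable.of_integral_ne_zero
    rw [H]; positivity
  have hi' := hi.comp_neg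
  have heq : (fun t : ℝ => Real.cosh (ν * t) * Real.cosh t ^ (-μ)) =
      fun t => (1/2) * (Real.exp (ν * t) * Real.cosh t ^ (-μ) +
        Real.exp (ν * -t) * Real.cosh (-t) ^ (-μ)) := by
    ext t
    rw [Real.cosh_neg, Real.cosh_eq (ν * t), mul_neg]; ring
  have hint : Integrable (fun t : ℝ => Real.cosh (ν * t) * Real.cosh t ^ (-μ)) := by
    rw [heq]; exact (hi.add hi').const_mul _
  refine ⟨hint.integrableOn, ?_⟩
  have h3 : ∫ t : ℝ, Real.cosh (ν * t) * Real.cosh t ^ (-μ) =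
      ∫ t : ℝ, Real.exp (ν * t) * Real.cosh t ^ (-μ) := by
    rw [heq, integral_const_mul, integral_add hi hi',
      integral_neg_eq_self (fun t : ℝ => Real.exp (ν * t) * Real.cosh t ^ (-μ))]
    ring
  have h4 := integral_comp_abs (f := fun t : ℝ => Real.cosh (ν * t) * Real.cosh t ^ (-μ))
  have h5 : ∀ t : ℝ, Real.cosh (ν * |t|) * Real.cosh |t| ^ (-μ) =
      Real.cosh (ν * t) * Real.cosh t ^ (-μ) := by
    intro t
    rcases abs_choice t with h | h <;> rw [h]
    rw [Real.cosh_neg, mul_neg, Real.cosh_neg]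
  simp_rw [h5] at h4
  rw [h3, H] at h4
  rw [show μ - 2 = μ - 1 - 1 by ring, Real.rpow_sub_one (by norm_num)]
  linarith

/-- Mellin transform of besselK. -/
lemma vg_mellin (ν α μ : ℝ) (hα : 0 < α) (h : |ν| < μ) :
    IntegrableOn (fun x : ℝ => x ^ (μ - 1) * besselK ν (α * x)) (Set.Ioi 0) ∧
    ∫ x in Set.Ioi (0:ℝ), x ^ (μ - 1) * besselK ν (α * x) =
      Real.Gamma μ * α ^ (-μ) *
        ∫ t in Set.Ioi (0:ℝ), Real.cosh (ν * t) * Real.cosh t ^ (-μ) := by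
  have hμ : 0 < μ := (abs_nonneg _).trans_lt h
  obtain ⟨hJ, -⟩ := vg_J ν μ h
  let F : ℝ × ℝ → ℝ := fun p =>
    p.1 ^ (μ - 1) * (Real.exp (-(α * p.1) * Real.cosh p.2) * Real.cosh (ν * p.2))
  have hFm : Measurable F := by
    have : Measurable Real.cosh := Real.measurable_cosh
    fun_prop
  have hin : ∀ t : ℝ, IntegrableOn (fun x => F (x, t)) (Set.Ioi 0) ∧
      ∫ x in Set.Ioi (0:ℝ), F (x, t) = Real.Gamma μ * α ^ (-μ) *
        (Real.cosh (ν * t) * Real.cosh t ^ (-μ)) := by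
    intro t
    have hc := Real.cosh_pos t
    have hc' := Real.cosh_pos (ν * t)
    have e : ∀ x : ℝ, F (x, t) = Real.cosh (ν * t) *
        (x ^ (μ - 1) * Real.exp (-(α * Real.cosh t * x))) := by
      intro x
      simp only [F]
      rw [show -(α * x) * Real.cosh t = -(α * Real.cosh t * x) by ring]; ring
    have hI : ∫ x in Set.Ioi (0:ℝ), F (x, t) = Real.Gamma μ * α ^ (-μ) *
        (Real.cosh (ν * t) * Real.cosh t ^ (-μ)) := by
      simp_rw [e]
      rw [integral_const_mul, Real.integral_rpow_mul_exp_neg_mul_Ioi hμ (by positivity),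
        one_div, Real.inv_rpow (by positivity), ← Real.rpow_neg (by positivity),
        Real.mul_rpow hα.le hc.le]
      ring
    refine ⟨?_, hI⟩
    apply Integrable.of_integral_ne_zero
    rw [hI]
    have := Real.Gamma_pos_of_pos hμ
    positivity
  have hF : Integrable F ((volume.restrict (Set.Ioi 0)).prod (volume.restrict (Set.Ioi 0))) := by
    rw [integrable_prod_iff' hFm.aestronglyMeasurable]
    refine ⟨Eventually.of_forall fun t => (hin t).1, ?_⟩
    have : ∀ t : ℝ, ∫ x in Set.Ioi (0:ℝ), ‖F (x, t)‖ = Real.Gamma μ * α ^ (-μ) *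
        (Real.cosh (ν * t) * Real.cosh t ^ (-μ)) := by
      intro t
      rw [← (hin t).2]
      refine setIntegral_congr_fun measurableSet_Ioi fun x hx => ?_
      have hx : 0 < x := hx
      have hc' := Real.cosh_pos (ν * t)
      exact Real.norm_of_nonneg (by simp only [F]; positivity)
    simp_rw [this]
    exact hJ.const_mul _
  have e : ∀ x : ℝ, x ^ (μ - 1) * besselK ν (α * x) = ∫ t in Set.Ioi (0:ℝ), F (x, t) := by
    intro x
    simp only [F, besselK]
    rw [integral_const_mul]
  simp_rw [e]
  refine ⟨hF.integral_prod_left, ?_⟩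
  rw [integral_integral_swap hF, ← integral_const_mul]
  simp_rw [(hin _).2]

lemma vg_besselK_meas (ν : ℝ) : Measurable (besselK ν) := by
  have : Measurable (Function.uncurry fun x t : ℝ =>
      Real.exp (-x * Real.cosh t) * Real.cosh (ν * t)) := by
    have : Measurable Real.cosh := Real.measurable_cosh
    unfold Function.uncurry
    fun_prop
  exact (this.stronglyMeasurable.integral_prod_right
    (ν := volume.restrict (Set.Ioi (0:ℝ)))).measurable

lemma vg_besselK_nonneg (ν x : ℝ) : 0 ≤ besselK ν x := by
  unfold besselK
  refine integral_nonneg fun t => ?_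
  have := Real.cosh_pos (ν * t)
  positivity

/-- The half-line moments. -/
noncomputable def vgI (ν α : ℝ) (m : ℕ) : ℝ :=
  α ^ (-(ν + m + 1)) * 2 ^ (ν + m - 1) *
    (Real.Gamma (ν + (m + 1) / 2) * Real.Gamma ((m + 1) / 2))

lemma vg_abs_lt (ν : ℝ) (hν : ν > -1/2) (m : ℕ) : |ν| < ν + m + 1 := by
  have : (0:ℝ) ≤ m := Nat.cast_nonneg m
  rw [abs_lt]; constructor <;> linarith

lemma vgI_pos (ν α : ℝ) (hν : ν > -1/2) (hα : 0 < α) (m : ℕ) : 0 < vgI ν α m := by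
  unfold vgI
  have : (0:ℝ) ≤ m := Nat.cast_nonneg m
  have h1 := Real.Gamma_pos_of_pos (show 0 < ν + ((m:ℝ) + 1) / 2 by linarith)
  have h2 := Real.Gamma_pos_of_pos (show 0 < ((m:ℝ) + 1) / 2 by linarith)
  positivity

lemma vgI_eq_J (ν α : ℝ) (hν : ν > -1/2) (m : ℕ) :
    vgI ν α m = Real.Gamma (ν + m + 1) * α ^ (-(ν + m + 1)) *
      ∫ t in Set.Ioi (0:ℝ), Real.cosh (ν * t) * Real.cosh t ^ (-(ν + m + 1)) := by
  have h := vg_abs_lt ν hν m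
  have g := Real.Gamma_pos_of_pos ((abs_nonneg _).trans_lt h)
  rw [(vg_J ν _ h).2, vgI, show ν + m + 1 - 2 = ν + m - 1 by ring,
    show (ν + m + 1 + ν) / 2 = ν + ((m:ℝ) + 1) / 2 by ring,
    show (ν + m + 1 - ν) / 2 = ((m:ℝ) + 1) / 2 by ring]
  field_simp

lemma vg_half (ν α : ℝ) (hν : ν > -1/2) (hα : 0 < α) (m : ℕ) :
    ∫ y in Set.Ioi (0:ℝ), y ^ m * (y ^ ν * besselK ν (α * y)) = vgI ν α m := by
  rw [vgI_eq_J ν α hν m, ← (vg_mellin ν α _ hα (vg_abs_lt ν hν m)).2]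
  refine setIntegral_congr_fun measurableSet_Ioi fun y hy => ?_
  have hy : 0 < y := hy
  rw [show ν + m + 1 - 1 = ν + (m:ℝ) by ring, Real.rpow_add hy, Real.rpow_natCast]
  ring

lemma vg_G_norm (ν α x : ℝ) (m : ℕ) :
    ‖x ^ m * (|x| ^ ν * besselK ν (α * |x|))‖ = |x| ^ m * (|x| ^ ν * besselK ν (α * |x|)) := by
  rw [norm_mul, norm_pow, Real.norm_eq_abs, Real.norm_of_nonneg]
  have := vg_besselK_nonneg ν (α * |x|)
  positivity

lemma vg_G_norm_int (ν α : ℝ) (hν : ν > -1/2) (hα : 0 < α) (m : ℕ) :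
    ∫ x : ℝ, ‖x ^ m * (|x| ^ ν * besselK ν (α * |x|))‖ = 2 * vgI ν α m := by
  simp_rw [vg_G_norm]
  rw [← vg_half ν α hν hα m]
  exact integral_comp_abs (f := fun y => y ^ m * (y ^ ν * besselK ν (α * y)))

lemma vg_G_integrable (ν α : ℝ) (hν : ν > -1/2) (hα : 0 < α) (m : ℕ) :
    Integrable (fun x : ℝ => x ^ m * (|x| ^ ν * besselK ν (α * |x|))) := by
  have h : Integrable (fun x : ℝ => ‖x ^ m * (|x| ^ ν * besselK ν (α * |x|))‖) := by
    apply Integrable.of_integral_ne_zero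
    rw [vg_G_norm_int ν α hν hα]
    have := vgI_pos ν α hν hα m
    positivity
  refine (integrable_norm_iff ?_).1 h
  have := vg_besselK_meas ν
  apply Measurable.aestronglyMeasurable
  have h2 : Measurable fun x : ℝ => |x| := measurable_id.abs
  exact (measurable_id.pow_const m).mul ((h2.pow_const ν).mul (this.comp (h2.const_mul α)))

lemma vg_G_even (ν α : ℝ) (hν : ν > -1/2) (hα : 0 < α) (m : ℕ) (hm : Even m) :
    ∫ x : ℝ, x ^ m * (|x| ^ ν * besselK ν (α * |x|)) = 2 * vgI ν α m := by
  rw [← vg_G_norm_int ν α hν hα m]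
  congr 1; ext x
  rw [vg_G_norm, hm.pow_abs]

lemma vg_G_odd (ν α : ℝ) (m : ℕ) (hm : Odd m) :
    ∫ x : ℝ, x ^ m * (|x| ^ ν * besselK ν (α * |x|)) = 0 := by
  have h := integral_neg_eq_self (fun x : ℝ => x ^ m * (|x| ^ ν * besselK ν (α * |x|))) volume
  simp only [abs_neg, hm.neg_pow, neg_mul] at h
  rw [integral_neg] at h
  linarith

lemma vg_summable (ν α β : ℝ) (hν : ν > -1/2) (hβ : |β| < α) (k : ℕ) :
    Summable fun n : ℕ => |β| ^ n / (Nat.factorial n) * (2 * vgI ν α (k + n)) := by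
  have hα : 0 < α := (abs_nonneg _).trans_lt hβ
  have hμ : 0 < ν + k + 1 := (abs_nonneg _).trans_lt (vg_abs_lt ν hν k)
  set J : ℝ := ∫ t in Set.Ioi (0:ℝ), Real.cosh (ν * t) * Real.cosh t ^ (-(ν + k + 1)) with hJ
  have hJ0 : 0 ≤ J := integral_nonneg fun t => by
    have := Real.cosh_pos (ν * t); have := Real.cosh_pos t; positivity
  have hs : Summable fun n : ℕ => Real.Gamma (ν + k + 1 + n) * (|β| / α) ^ n / Nat.factorial n := by
    have hr : |β| / α < 1 := (div_lt_one hα).2 hβ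
    obtain ⟨r, hr0, hr1⟩ := exists_between hr
    refine summable_of_ratio_norm_eventually_le hr1 ?_
    have hlim : Tendsto (fun n : ℕ => |β| / α * ((ν + k + (n + 1 : ℕ)) / (n + 1 : ℕ))) atTop
        (nhds (|β| / α * (0 + 1))) := by
      refine Tendsto.const_mul _ ?_
      have h1 : Tendsto (fun n : ℕ => (ν + k) / ((n + 1 : ℕ) : ℝ)) atTop (nhds 0) :=
        (tendsto_const_div_atTop_nhds_zero_nat (ν + k)).comp (tendsto_add_atTop_nat 1)
      refine (h1.add_const 1).congr fun n => ?_
      have : ((n + 1 : ℕ) : ℝ) ≠ 0 := by positivity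
      field_simp
    filter_upwards [hlim.eventually_le_const (by simpa using hr0)] with n hn
    have hg : 0 < ν + k + 1 + n := by positivity
    have hG := Real.Gamma_pos_of_pos hg
    rw [Real.norm_of_nonneg, Real.norm_of_nonneg (by positivity)]
    · have e : Real.Gamma (ν + k + 1 + (n + 1 : ℕ)) * (|β| / α) ^ (n + 1) / Nat.factorial (n + 1) =
          (|β| / α * ((ν + k + (n + 1 : ℕ)) / (n + 1 : ℕ))) *
            (Real.Gamma (ν + k + 1 + n) * (|β| / α) ^ n / Nat.factorial n) := by
        rw [show ν + k + 1 + ((n + 1 : ℕ):ℝ) = (ν + k + 1 + n) + 1 by push_cast; ring,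
          Real.Gamma_add_one hg.ne', Nat.factorial_succ]
        push_cast
        rw [pow_succ]
        generalize |β| / α = q
        field_simp
        ring
      rw [e]
      exact mul_le_mul_of_nonneg_right hn (by positivity)
    · have : 0 < ν + k + 1 + (n + 1 : ℕ) := by positivity
      have := Real.Gamma_pos_of_pos this
      positivity
  refine Summable.of_nonneg_of_le (fun n => ?_) (fun n => ?_)
    (hs.mul_left (2 * α ^ (-(ν + k + 1)) * J))
  · have := vgI_pos ν α hν hα (k + n)
    positivity
  · have hle : ∫ t in Set.Ioi (0:ℝ), Real.cosh (ν * t) *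
        Real.cosh t ^ (-(ν + (k + n : ℕ) + 1)) ≤ J := by
      rw [hJ]
      refine setIntegral_mono_on (vg_J ν _ (vg_abs_lt ν hν _)).1 (vg_J ν _ (vg_abs_lt ν hν _)).1
        measurableSet_Ioi fun t _ => ?_
      have := Real.cosh_pos (ν * t)
      refine mul_le_mul_of_nonneg_left ?_ this.le
      refine Real.rpow_le_rpow_of_exponent_le (Real.one_le_cosh t) ?_
      push_cast
      have : (0:ℝ) ≤ n := Nat.cast_nonneg n
      linarith
    have hg : 0 < ν + k + 1 + n := by positivity
    have hG := Real.Gamma_pos_of_pos hg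
    rw [vgI_eq_J ν α hν]
    calc _ ≤ |β| ^ n / (Nat.factorial n) * (2 * (Real.Gamma (ν + (k + n : ℕ) + 1) *
          α ^ (-(ν + (k + n : ℕ) + 1)) * J)) := by
          rw [show ν + ((k + n : ℕ) : ℝ) + 1 = ν + k + 1 + n by push_cast; ring] at hle ⊢
          gcongr
      _ = _ := by
          rw [show ν + ((k + n : ℕ) : ℝ) + 1 = ν + k + 1 + n by push_cast; ring, neg_add,
            Real.rpow_add hα, Real.rpow_neg hα.le (n:ℝ), Real.rpow_natCast, div_pow]
          field_simp

lemma vg_Gamma_asc (u : ℝ) (hu : 0 < u) (j : ℕ) :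
    Real.Gamma (u + j) = ascFactorial u j * Real.Gamma u := by
  induction j with
  | zero => simp [ascFactorial]
  | succ j ih =>
    have : 0 < u + j := by positivity
    rw [show u + ((j + 1 : ℕ) : ℝ) = u + j + 1 by push_cast; ring, Real.Gamma_add_one this.ne', ih]
    simp only [ascFactorial, Finset.prod_range_succ]
    ring

lemma vg_fact (j : ℕ) :
    ((2 * j + 1).factorial : ℝ) = 4 ^ j * j.factorial * ascFactorial (3/2) j := by
  induction j with
  | zero => simp [ascFactorial]
  | succ j ih =>
    rw [show 2 * (j + 1) + 1 = (2 * j + 1) + 1 + 1 by ring, Nat.factorial_succ (2 * j + 1 + 1),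
      Nat.factorial_succ (2 * j + 1), Nat.factorial_succ j]
    push_cast
    rw [ih]
    simp only [ascFactorial, Finset.prod_range_succ]
    ring

lemma vg_asc_pos (u : ℝ) (hu : 0 < u) (j : ℕ) : 0 < ascFactorial u j :=
  Finset.prod_pos fun i _ => by positivity

lemma vg_moment_series (ν α β : ℝ) (hν : ν > -1/2) (hβ : |β| < α)
    (k : ℕ) (hk : Odd k) :
    ∫ x : ℝ, x ^ k * (Real.exp (β * x) * |x| ^ ν * besselK ν (α * |x|)) =
      ∑' j : ℕ, β ^ (2 * j + 1) / ((2 * j + 1).factorial) * (2 * vgI ν α (k + (2 * j + 1))) := by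
  have hα : 0 < α := (abs_nonneg _).trans_lt hβ
  let F : ℕ → ℝ → ℝ := fun n x =>
    β ^ n / (Nat.factorial n) * (x ^ (k + n) * (|x| ^ ν * besselK ν (α * |x|)))
  have hF : ∀ n, Integrable (F n) := fun n => (vg_G_integrable ν α hν hα _).const_mul _
  have hN : Summable fun n => ∫ x, ‖F n x‖ := by
    refine (vg_summable ν α β hν hβ k).congr fun n => ?_
    simp only [F, norm_mul (β ^ n / _)]
    rw [integral_const_mul, vg_G_norm_int ν α hν hα]
    simp
  have hS := (hasSum_integral_of_summable_integral_norm hF hN).tsum_eq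
  have hsum : ∀ x, ∑' n, F n x = x ^ k * (Real.exp (β * x) * |x| ^ ν * besselK ν (α * |x|)) := by
    intro x
    have h1 : HasSum (fun n : ℕ => (β * x) ^ n / (Nat.factorial n)) (Real.exp (β * x)) := by
      rw [Real.exp_eq_exp_ℝ]
      exact NormedSpace.expSeries_div_hasSum_exp (β * x)
    have h2 := h1.mul_right (x ^ k * (|x| ^ ν * besselK ν (α * |x|)))
    rw [show x ^ k * (Real.exp (β * x) * |x| ^ ν * besselK ν (α * |x|)) =
      Real.exp (β * x) * (x ^ k * (|x| ^ ν * besselK ν (α * |x|))) by ring, ← h2.tsum_eq]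
    congr 1; ext n
    simp only [F]
    rw [mul_pow, pow_add]; ring
  simp_rw [hsum] at hS
  rw [← hS]
  have hinj : Function.Injective fun j : ℕ => 2 * j + 1 := fun a b h => by
    simp only at h; omega
  rw [← hinj.tsum_eq]
  · congr 1; ext j
    simp only [F]
    rw [integral_const_mul, vg_G_even ν α hν hα]
    exact hk.add_odd ⟨j, rfl⟩
  · intro n hn
    by_contra hc
    apply hn
    have hev : Even n := by
      rw [← Nat.not_odd_iff_even]
      rintro ⟨j, rfl⟩
      exact hc ⟨j, rfl⟩
    simp only [F]
    rw [integral_const_mul, vg_G_odd ν α _ (hk.add_even hev), mul_zero]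

theorem vg_odd_moment (ν α β : ℝ) (hν : ν > -1/2) (hβ : |β| < α)
    (k : ℕ) (hk : Odd k) (hk0 : 0 < k) :
    ∫ x : ℝ, x ^ k * vgDensity ν α β x =
      2 ^ (k + 1) * β * (1 - β ^ 2 / α ^ 2) ^ (ν + 1/2) /
          (Real.sqrt π * α ^ (k + 1) * Real.Gamma (ν + 1/2)) *
        Real.Gamma (ν + (k : ℝ)/2 + 1) * Real.Gamma ((k : ℝ)/2 + 1) *
        hyp2F1 ((k : ℝ)/2 + 1) (ν + (k : ℝ)/2 + 1) (3/2) (β ^ 2 / α ^ 2) := by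
  have hα : 0 < α := (abs_nonneg _).trans_lt hβ
  have hβ2 : β ^ 2 < α ^ 2 := by rw [← sq_abs β]; gcongr
  have hk' : (0:ℝ) ≤ k := Nat.cast_nonneg k
  have hGν := Real.Gamma_pos_of_pos (show 0 < ν + 1/2 by linarith)
  have e0 : ∀ x : ℝ, x ^ k * vgDensity ν α β x =
      (α ^ 2 - β ^ 2) ^ (ν + 1/2) / (Real.sqrt π * (2 * α) ^ ν * Real.Gamma (ν + 1/2)) *
      (x ^ k * (Real.exp (β * x) * |x| ^ ν * besselK ν (α * |x|))) := by
    intro x; unfold vgDensity; ring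
  simp_rw [e0]
  rw [integral_const_mul, vg_moment_series ν α β hν hβ k hk, hyp2F1, ← tsum_mul_left,
    ← tsum_mul_left]
  congr 1; ext j
  have p1 := vg_asc_pos (3/2) (by norm_num) j
  have e1 : (α ^ 2 - β ^ 2) ^ (ν + 1/2) = α ^ ν * α ^ ν * α * (1 - β ^ 2 / α ^ 2) ^ (ν + 1/2) := by
    rw [show α ^ 2 - β ^ 2 = α ^ 2 * (1 - β ^ 2 / α ^ 2) by field_simp,
      Real.mul_rpow (by positivity) (by rw [sub_nonneg, div_le_one (by positivity)]; exact hβ2.le)]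
    congr 1
    rw [← Real.rpow_natCast α 2, ← Real.rpow_mul hα.le,
      show ((2:ℕ):ℝ) * (ν + 1/2) = ν + ν + 1 by push_cast; ring, Real.rpow_add hα,
      Real.rpow_add hα, Real.rpow_one]
  have e2 : vgI ν α (k + (2 * j + 1)) = (α ^ ν)⁻¹ * (α ^ (k + 2 * j + 2))⁻¹ *
      (2 ^ ν * 2 ^ (k + 2 * j)) * ((ascFactorial (ν + (k : ℝ)/2 + 1) j *
        Real.Gamma (ν + (k : ℝ)/2 + 1)) * (ascFactorial ((k : ℝ)/2 + 1) j *
        Real.Gamma ((k : ℝ)/2 + 1))) := by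
    rw [← vg_Gamma_asc _ (by linarith), ← vg_Gamma_asc _ (by linarith), vgI,
      show -(ν + ((k + (2 * j + 1) : ℕ) : ℝ) + 1) = -ν + -((k + 2 * j + 2 : ℕ) : ℝ) by
        push_cast; ring,
      show ν + ((k + (2 * j + 1) : ℕ) : ℝ) - 1 = ν + ((k + 2 * j : ℕ) : ℝ) by push_cast; ring,
      show ν + (((k + (2 * j + 1) : ℕ) : ℝ) + 1) / 2 = ν + (k : ℝ)/2 + 1 + j by push_cast; ring,
      show (((k + (2 * j + 1) : ℕ) : ℝ) + 1) / 2 = (k : ℝ)/2 + 1 + j by push_cast; ring,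
      Real.rpow_add hα, Real.rpow_neg hα.le, Real.rpow_neg hα.le, Real.rpow_natCast,
      Real.rpow_add (by norm_num), Real.rpow_natCast]
  rw [e1, e2, vg_fact, Real.mul_rpow (by norm_num) hα.le]
  have q1 : 0 < α ^ ν := by positivity
  have q2 : (0:ℝ) < 2 ^ ν := by positivity
  have q3 : (2:ℝ) ^ (k + 2 * j) = 2 ^ k * 4 ^ j := by
    rw [pow_add, pow_mul]; norm_num
  have q4 : (0:ℝ) < √π := by positivity
  rw [q3]
  generalize (1 - β ^ 2 / α ^ 2) ^ (ν + 1/2) = A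
  generalize α ^ ν = B at *
  generalize (2:ℝ) ^ ν = D at *
  rw [div_pow, ← pow_mul, ← pow_mul, pow_add α, pow_add α, pow_succ β, pow_succ (2:ℝ) k,
    pow_succ α k]
  field_simp
end

section
/- Let ν > -1/2 and 0 ≤ |β| < α, and let p be the variance-gamma density with parameters (ν, α, β, 0). Then for every real k > k_* = max{-1, -2ν-1}, ∫_ℝ |x|^k p(x) dx = 2M · Σ_{j=0}^∞ (β^{2j} / (2j)!) · (2^{ν+k+2j-1} / α^{ν+k+2j+1}) · Γ(ν + j + (k+1)/2) Γ(j + (k+1)/2), where M = (α² - β²)^{ν+1/2} / (√π (2α)^ν Γ(ν + 1/2)). -/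
open MeasureTheory Real Filter

open scoped ENNReal

lemma vg_fold (f : ℝ → ℝ≥0∞) (hf : Measurable f) :
    ∫⁻ x, f x = ∫⁻ x in Set.Ioi (0:ℝ), (f x + f (-x)) := by
  rw [lintegral_add_left hf, ← lintegral_add_compl f (measurableSet_Ioi (a := (0:ℝ)))]
  congr 1
  rw [Set.compl_Ioi, setLIntegral_congr Iio_ae_eq_Iic.symm]
  have h := (Measure.measurePreserving_neg (volume : Measure ℝ)).setLIntegral_comp_preimage
    (measurableSet_Iio (a := (0:ℝ))) hf
  rw [← h]
  congr 2
  ext x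
  simp

lemma vg_exp (f : ℝ → ℝ≥0∞) :
    ∫⁻ x in Set.Ioi (0:ℝ), f x = ∫⁻ s : ℝ, ENNReal.ofReal (Real.exp s) * f (Real.exp s) := by
  have h := lintegral_image_eq_lintegral_abs_deriv_mul (f := Real.exp) (f' := Real.exp)
    MeasurableSet.univ (fun x _ => (Real.hasDerivAt_exp x).hasDerivWithinAt)
    Real.exp_injective.injOn f
  simpa [Set.image_univ, Real.range_exp, abs_of_pos (Real.exp_pos _)] using h

lemma vg_scale (f : ℝ → ℝ≥0∞) :
    ∫⁻ x : ℝ, f x = 2 * ∫⁻ s : ℝ, f (2 * s) := by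
  have h := lintegral_image_eq_lintegral_abs_deriv_mul (f := fun x : ℝ => 2 * x)
    (f' := fun _ => 2)
    MeasurableSet.univ (fun x _ => by
      have h := (hasDerivAt_id x).const_mul (2:ℝ)
      simp only [mul_one, id] at h
      exact h.hasDerivWithinAt)
    (mul_right_injective₀ (two_ne_zero)).injOn f
  have h2 : Set.range (fun x : ℝ => 2 * x) = Set.univ :=
    (mul_left_surjective₀ (two_ne_zero)).range_eq
  rw [Set.image_univ, h2] at h
  simp only [Measure.restrict_univ] at h
  rw [h, lintegral_const_mul']
  · simp
  · simp

lemma vg_gamma (a : ℝ) (ha : 0 < a) :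
    ∫⁻ p : ℝ, ENNReal.ofReal (Real.exp (a * p - Real.exp p)) = ENNReal.ofReal (Real.Gamma a) := by
  rw [Real.Gamma_eq_integral ha, ofReal_integral_eq_lintegral_ofReal
    (Real.GammaIntegral_convergent ha), vg_exp]
  · congr 1
    ext p
    rw [← ENNReal.ofReal_mul (Real.exp_pos _).le, ← Real.exp_mul, ← Real.exp_add, ← Real.exp_add]
    congr 2
    ring
  · refine (ae_restrict_mem measurableSet_Ioi).mono fun x hx => ?_
    have : (0:ℝ) < x := hx
    positivity

lemma vg_double (a b : ℝ) (ha : 0 < a) (hb : 0 < b) :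
    2 * ∫⁻ s : ℝ, ∫⁻ t : ℝ, ENNReal.ofReal
      (Real.exp ((a + b) * s + (a - b) * t - 2 * Real.exp s * Real.cosh t)) =
    ENNReal.ofReal (Real.Gamma a * Real.Gamma b) := by
  rw [ENNReal.ofReal_mul (Real.Gamma_pos_of_pos ha).le, mul_comm (ENNReal.ofReal _),
    ← vg_gamma a ha, ← vg_gamma b hb, ← lintegral_mul_const' _ _ (by rw [vg_gamma a ha]; simp)]
  have h1 : ∀ q : ℝ, ENNReal.ofReal (Real.exp (b * q - Real.exp q)) *
      ∫⁻ p : ℝ, ENNReal.ofReal (Real.exp (a * p - Real.exp p)) =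
      2 * ∫⁻ t : ℝ, ENNReal.ofReal (Real.exp (b * q - Real.exp q + (a * (2 * t + q) - Real.exp (2 * t + q)))) := by
    intro q
    rw [← lintegral_add_right_eq_self _ q, vg_scale, mul_left_comm,
      ← lintegral_const_mul' _ _ (by simp)]
    congr 2
    ext t
    rw [← ENNReal.ofReal_mul (Real.exp_pos _).le, ← Real.exp_add]
  simp_rw [h1]
  rw [lintegral_const_mul' _ _ (by simp)]
  congr 1
  conv_lhs => rw [lintegral_lintegral_swap (by
    apply Measurable.aemeasurable; unfold Function.uncurry; fun_prop)]
  conv_rhs => rw [lintegral_lintegral_swap (by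
    apply Measurable.aemeasurable; unfold Function.uncurry; fun_prop)]
  congr 1
  ext t
  conv_rhs => rw [← lintegral_add_right_eq_self _ (-t)]
  congr 1
  ext s
  congr 2
  have e1 : Real.exp (2 * t + (s + -t)) = Real.exp s * Real.exp t := by
    rw [← Real.exp_add]; congr 1; ring
  have e2 : Real.exp (s + -t) = Real.exp s * Real.exp (-t) := by
    rw [← Real.exp_add]
  rw [e1, e2, Real.cosh_eq]
  ring

/-- extended-valued Bessel integral -/
noncomputable def vgL (ν x : ℝ) : ℝ≥0∞ :=
  ∫⁻ t in Set.Ioi (0:ℝ), ENNReal.ofReal (Real.exp (-x * Real.cosh t) * Real.cosh (ν * t))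

lemma vgL_measurable (ν : ℝ) : Measurable (vgL ν) := by
  unfold vgL
  apply Measurable.lintegral_prod_right'
    (f := fun p : ℝ × ℝ => ENNReal.ofReal (Real.exp (-p.1 * Real.cosh p.2) * Real.cosh (ν * p.2)))
  fun_prop

lemma besselK_eq (ν x : ℝ) : besselK ν x = (vgL ν x).toReal := by
  unfold besselK vgL
  rw [integral_eq_lintegral_of_nonneg_ae]
  · exact Eventually.of_forall fun t => by
      have := Real.cosh_pos (ν * t)
      simp only [Pi.zero_apply]; positivity
  · apply Measurable.aestronglyMeasurable; fun_prop

lemma two_vgL (ν x : ℝ) :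
    2 * vgL ν x = ∫⁻ t : ℝ, ENNReal.ofReal (Real.exp (ν * t - x * Real.cosh t)) := by
  rw [vg_fold _ (by fun_prop), vgL, ← lintegral_const_mul' _ _ (by simp)]
  congr 1
  ext t
  rw [← ENNReal.ofReal_add (Real.exp_pos _).le (Real.exp_pos _).le,
    show (2:ℝ≥0∞) = ENNReal.ofReal 2 by simp, ← ENNReal.ofReal_mul (by norm_num)]
  congr 1
  rw [Real.cosh_neg, Real.cosh_eq (ν * t), sub_eq_add_neg, sub_eq_add_neg, Real.exp_add,
    Real.exp_add]
  ring_nf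

lemma vg_mellin_s6 (a b α : ℝ) (ha : 0 < a) (hb : 0 < b) (hα : 0 < α) :
    ∫⁻ x in Set.Ioi (0:ℝ), ENNReal.ofReal (x ^ (a + b - 1)) * vgL (a - b) (α * x) =
      ENNReal.ofReal (2 ^ (a + b - 2) / α ^ (a + b) * Real.Gamma a * Real.Gamma b) := by
  have key : 2 * (2 * ∫⁻ x in Set.Ioi (0:ℝ),
      ENNReal.ofReal (x ^ (a + b - 1)) * vgL (a - b) (α * x)) =
      ENNReal.ofReal ((2 / α) ^ (a + b)) * ENNReal.ofReal (Real.Gamma a * Real.Gamma b) := by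
    rw [vg_exp, ← lintegral_const_mul' 2 _ (by simp), ← vg_double a b ha hb,
      ← lintegral_add_right_eq_self _ (Real.log (2 / α)), mul_left_comm,
      ← lintegral_const_mul' (ENNReal.ofReal _) _ (by simp)]
    congr 2
    ext s
    have e1 : Real.exp (s + Real.log (2 / α)) = Real.exp s * (2 / α) := by
      rw [Real.exp_add, Real.exp_log (by positivity)]
    rw [← lintegral_const_mul' (ENNReal.ofReal _) _ (by simp), mul_left_comm, mul_left_comm 2,
      two_vgL, ← mul_assoc, ← lintegral_const_mul' _ _ (by finiteness)]
    congr 1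
    ext t
    rw [← ENNReal.ofReal_mul (by positivity), ← ENNReal.ofReal_mul (by positivity),
      ← ENNReal.ofReal_mul (by positivity)]
    congr 1
    rw [← Real.exp_mul, ← Real.exp_add, ← Real.exp_add, Real.rpow_def_of_pos (by positivity),
      ← Real.exp_add, e1]
    congr 1
    field_simp
    ring
  have e : ENNReal.ofReal (2 ^ (a + b - 2) / α ^ (a + b) * Real.Gamma a * Real.Gamma b) * 4 =
      ENNReal.ofReal ((2 / α) ^ (a + b)) * ENNReal.ofReal (Real.Gamma a * Real.Gamma b) := by
    have := Real.Gamma_pos_of_pos ha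
    have := Real.Gamma_pos_of_pos hb
    rw [← ENNReal.ofReal_mul (by positivity), show (4:ℝ≥0∞) = ENNReal.ofReal 4 by simp,
      ← ENNReal.ofReal_mul (by positivity), Real.rpow_sub (by norm_num),
      Real.div_rpow (by norm_num) hα.le]
    congr 1
    norm_num
    ring
  rw [← e, ← mul_assoc, mul_comm, show (2:ℝ≥0∞) * 2 = 4 by norm_num] at key
  exact (ENNReal.mul_left_inj (by norm_num) (by norm_num)).1 key

theorem vg_abs_moment_series (ν α β : ℝ) (hν : ν > -1/2) (hβ : |β| < α)
    (k : ℝ) (hk : k > max (-1) (-2*ν - 1)) :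
    ∫ x : ℝ, |x| ^ k * vgDensity ν α β x =
      2 * ((α ^ 2 - β ^ 2) ^ (ν + 1/2) / (Real.sqrt π * (2 * α) ^ ν * Real.Gamma (ν + 1/2))) *
        ∑' j : ℕ, β ^ (2 * j) / (Nat.factorial (2 * j)) *
          (2 ^ (ν + k + 2 * (j : ℝ) - 1) / α ^ (ν + k + 2 * (j : ℝ) + 1)) *
          Real.Gamma (ν + (j : ℝ) + (k + 1)/2) * Real.Gamma ((j : ℝ) + (k + 1)/2) := by
  have hα : 0 < α := (abs_nonneg β).trans_lt hβ
  obtain ⟨hk1, hk2⟩ := max_lt_iff.1 hk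
  have hm : ∀ j : ℕ, ∫⁻ x in Set.Ioi (0:ℝ), ENNReal.ofReal (x ^ (ν + k + 2 * (j:ℝ))) *
      vgL ν (α * x) = ENNReal.ofReal ((2 ^ (ν + k + 2 * (j : ℝ) - 1) / α ^ (ν + k + 2 * (j : ℝ) + 1)) *
          Real.Gamma (ν + (j : ℝ) + (k + 1)/2) * Real.Gamma ((j : ℝ) + (k + 1)/2)) := by
    intro j
    have hj : (0:ℝ) ≤ j := Nat.cast_nonneg j
    have := vg_mellin_s6 (ν + (j : ℝ) + (k + 1)/2) ((j : ℝ) + (k + 1)/2) α (by linarith)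
      (by linarith) hα
    convert this using 6 <;> ring_nf
  have hLm : Measurable fun x => vgL ν (α * x) := (vgL_measurable ν).comp (by fun_prop)
  -- finiteness of the Bessel integral almost everywhere
  have hfin : ∀ᵐ x ∂(volume.restrict (Set.Ioi (0:ℝ))), vgL ν (α * x) ≠ ⊤ := by
    have h0 := ae_lt_top (μ := volume.restrict (Set.Ioi (0:ℝ)))
      (f := fun x => ENNReal.ofReal (x ^ (ν + k + 2 * ((0:ℕ):ℝ))) * vgL ν (α * x))
      (by fun_prop) (by rw [hm 0]; simp)
    filter_upwards [h0, ae_restrict_mem measurableSet_Ioi] with x hx hx0 htop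
    have : 0 < x := hx0
    rw [htop, ENNReal.mul_top] at hx
    · exact lt_irrefl _ hx
    · simp only [ne_eq, ENNReal.ofReal_eq_zero, not_le]; positivity
  have hKm : Measurable fun x => besselK ν (α * |x|) := by
    simp_rw [besselK_eq]
    exact (hLm.comp (measurable_id.abs)).ennreal_toReal
  have hK0 : ∀ x, 0 ≤ besselK ν x := fun x => by rw [besselK_eq]; exact ENNReal.toReal_nonneg
  set M := (α ^ 2 - β ^ 2) ^ (ν + 1/2) / (Real.sqrt π * (2 * α) ^ ν * Real.Gamma (ν + 1/2)) with hM
  have hG : Measurable fun x : ℝ => |x| ^ k * (Real.exp (β * x) * |x| ^ ν * besselK ν (α * |x|)) := by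
    fun_prop
  have hmain : ∫⁻ x : ℝ, ENNReal.ofReal
      (|x| ^ k * (Real.exp (β * x) * |x| ^ ν * besselK ν (α * |x|))) =
      ∑' j : ℕ, ENNReal.ofReal (2 * (β ^ (2 * j) / (Nat.factorial (2 * j)) *
          (2 ^ (ν + k + 2 * (j : ℝ) - 1) / α ^ (ν + k + 2 * (j : ℝ) + 1)) *
          Real.Gamma (ν + (j : ℝ) + (k + 1)/2) * Real.Gamma ((j : ℝ) + (k + 1)/2))) := by
    rw [vg_fold _ (by fun_prop)]
    have hterm : ∀ᵐ x ∂(volume.restrict (Set.Ioi (0:ℝ))),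
        ENNReal.ofReal (|x| ^ k * (Real.exp (β * x) * |x| ^ ν * besselK ν (α * |x|))) +
        ENNReal.ofReal (|-x| ^ k * (Real.exp (β * -x) * |-x| ^ ν * besselK ν (α * |-x|))) =
        ∑' j : ℕ, ENNReal.ofReal (2 * (β ^ (2 * j) / (Nat.factorial (2 * j)))) *
          (ENNReal.ofReal (x ^ (ν + k + 2 * (j:ℝ))) * vgL ν (α * x)) := by
      filter_upwards [hfin, ae_restrict_mem measurableSet_Ioi] with x hx hx0
      have hx1 : 0 < x := hx0
      have hKx := hK0 (α * x)
      have hc := (Real.hasSum_cosh (β * x)).mul_left (2 * x ^ (ν + k))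
      simp_rw [← mul_assoc]
      rw [ENNReal.tsum_mul_right, abs_neg, abs_of_pos hx1,
        ← ENNReal.ofReal_add (by positivity) (by positivity), ← ENNReal.ofReal_toReal hx,
        ← besselK_eq]
      have hnn : ∀ j : ℕ, (0:ℝ) ≤ 2 * (β ^ (2 * j) / (Nat.factorial (2 * j) : ℝ)) := fun j => by
        rw [pow_mul]; positivity
      simp_rw [← ENNReal.ofReal_mul (hnn _)]
      rw [← ENNReal.ofReal_tsum_of_nonneg]
      · rw [← ENNReal.ofReal_mul]
        · congr 1
          have : (fun j : ℕ => 2 * (β ^ (2 * j) / (Nat.factorial (2 * j) : ℝ)) *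
              x ^ (ν + k + 2 * (j:ℝ))) = fun j : ℕ => 2 * x ^ (ν + k) * ((β * x) ^ (2 * j) / (Nat.factorial (2 * j) : ℝ)) := by
            ext j
            rw [Real.rpow_add hx1 (ν + k), mul_pow, ← Real.rpow_natCast x (2 * j)]
            push_cast
            ring
          rw [this, hc.tsum_eq, Real.cosh_eq, Real.rpow_add hx1]
          ring_nf
        · refine tsum_nonneg fun j => ?_
          rw [pow_mul]; positivity
      · intro j
        rw [pow_mul]; positivity
      · refine hc.summable.congr fun j => ?_
        rw [Real.rpow_add hx1 (ν + k), mul_pow, ← Real.rpow_natCast x (2 * j)]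
        push_cast
        ring
    rw [lintegral_congr_ae hterm, lintegral_tsum (fun j => by fun_prop)]
    congr 1
    ext j
    rw [lintegral_const_mul' _ _ ENNReal.ofReal_ne_top, hm, ← ENNReal.ofReal_mul (by rw [pow_mul]; positivity)]
    congr 1
    ring
  have hL : ∀ x, |x| ^ k * vgDensity ν α β x =
      M * (|x| ^ k * (Real.exp (β * x) * |x| ^ ν * besselK ν (α * |x|))) := by
    intro x
    unfold vgDensity
    ring
  simp_rw [hL]
  rw [integral_const_mul, integral_eq_lintegral_of_nonneg_ae
    (Eventually.of_forall fun x => by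
      have := hK0 (α * |x|)
      simp only [Pi.zero_apply]; positivity) hG.aestronglyMeasurable, hmain,
    ENNReal.tsum_toReal_eq (fun _ => ENNReal.ofReal_ne_top), mul_comm 2 M, mul_assoc, ← tsum_mul_left (a := (2:ℝ))]
  congr 1
  refine tsum_congr fun j => ?_
  rw [ENNReal.toReal_ofReal]
  have hj : (0:ℝ) ≤ j := Nat.cast_nonneg j
  have := Real.Gamma_pos_of_pos (show 0 < ν + (j : ℝ) + (k + 1)/2 by linarith)
  have := Real.Gamma_pos_of_pos (show 0 < (j : ℝ) + (k + 1)/2 by linarith)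
  rw [pow_mul]
  positivity
end
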